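/- (Existence part of Theorem 1.) Let l > 0 and set λ̄_γ = λ₁ − ε_γ with ε_γ = (4π v₁(0)/γ)√(λ₁/l). Then for every γ > 0 large enough that λ̄_γ > 0, there exists β_γ > 0 such that the problem Δu = λ̄_γ u + β_γ u exp(u²) in Ω, u > 0 in Ω, u = 0 on ∂Ω admits a smooth radially symmetric solution u_γ satisfying u_γ(0) = γ. -/

import Mathlib

open Real Set Filter MeasureTheory

noncomputable section

/-- The radial Laplacian with the sign convention Δ = −div(∇·):
for a radial C² function, (Δu)(r) = −u''(r) − u'(r)/r. -/
def radLap (u : ℝ → ℝ) (r : ℝ) : ℝ := -(deriv (deriv u) r) - deriv u r / r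

/-- `EigenCtx lam1 v1` : λ₁ > 0 is the first radial Dirichlet eigenvalue of Δ = −div∇
on the unit disk, with radial eigenfunction v₁: v₁ smooth on [0,1], Δv₁ = λ₁v₁ in Ω,
v₁ > 0 in Ω, v₁(1) = 0 and ∫_Ω v₁² dy = ∫₀¹ v₁(r)² 2πr dr = 1. -/
def EigenCtx (lam1 : ℝ) (v1 : ℝ → ℝ) : Prop :=
  0 < lam1 ∧ ContDiffOn ℝ (⊤ : ℕ∞) v1 (Set.Icc 0 1) ∧
    (∀ r ∈ Set.Ioo (0:ℝ) 1, radLap v1 r = lam1 * v1 r) ∧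
    (∀ r ∈ Set.Ico (0:ℝ) 1, 0 < v1 r) ∧ v1 1 = 0 ∧
    (∫ r in Set.Ioo (0:ℝ) 1, (v1 r) ^ 2 * (2 * π * r)) = 1

/-- `IsRadSol lam beta gam u` : u is a smooth radial function on the closed unit disk,
positive in the open disk, vanishing on the boundary, with central value γ, solving
Δu = λu + βu e^{u²} in Ω (radially). -/
def IsRadSol (lam beta gam : ℝ) (u : ℝ → ℝ) : Prop :=
  ContDiffOn ℝ (⊤ : ℕ∞) u (Set.Icc 0 1) ∧
    (∀ r ∈ Set.Ioo (0:ℝ) 1,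
      radLap u r = lam * u r + beta * u r * Real.exp ((u r) ^ 2)) ∧
    (∀ r ∈ Set.Ico (0:ℝ) 1, 0 < u r) ∧ u 1 = 0 ∧ u 0 = gam

/-- λ̄_γ = λ₁ − ε_γ with ε_γ = (4π v₁(0)/γ)√(λ₁/l). -/
def lamBar (lam1 v10 l γ : ℝ) : ℝ := lam1 - 4 * π * v10 / γ * Real.sqrt (lam1 / l)

/-- The family (β_γ, u_γ) of Theorem 1: for every γ > 0 with λ̄_γ > 0, β_γ > 0 and u_γ
is a smooth positive radial solution of Δu = λ̄_γ u + β_γ u e^{u²} with u_γ(0) = γ. -/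
def GoodFamily (lam1 : ℝ) (v1 : ℝ → ℝ) (l : ℝ) (β : ℝ → ℝ) (u : ℝ → ℝ → ℝ) : Prop :=
  ∀ γ : ℝ, 0 < γ → 0 < lamBar lam1 (v1 0) l γ →
    0 < β γ ∧ IsRadSol (lamBar lam1 (v1 0) l γ) (β γ) γ (u γ)

/-- Dirichlet energy ∫_Ω |∇u|² dy of a radial function, = ∫₀¹ u'(r)² 2πr dr. -/
def dirEnergy (u : ℝ → ℝ) : ℝ := ∫ r in Set.Ioo (0:ℝ) 1, (deriv u r) ^ 2 * (2 * π * r)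

/-- L² norm ‖u‖_{L²(Ω)} of a radial function. -/
def l2norm (u : ℝ → ℝ) : ℝ := Real.sqrt (∫ r in Set.Ioo (0:ℝ) 1, (u r) ^ 2 * (2 * π * r))

open scoped Topology NNReal BoundedContinuousFunction ContDiff

/-- The mean `∫₀¹ τ h(sτ) dτ`, so that `s² · radMean h s = ∫₀ˢ t h(t) dt`. -/
def radMean (h : ℝ → ℝ) (s : ℝ) : ℝ := ∫ τ in (0:ℝ)..1, τ * h (s * τ)

/-- The radial solution `w` of `w'' + w'/r = h` with `w(0) = w'(0) = 0`. -/
def radInt (h : ℝ → ℝ) (r : ℝ) : ℝ := ∫ s in (0:ℝ)..r, s * radMean h s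

lemma continuous_radMean_param {X : Type*} [TopologicalSpace X] [FirstCountableTopology X]
    {H : X → ℝ → ℝ} (hH : Continuous (Function.uncurry H)) :
    Continuous fun p : X × ℝ => radMean (H p.1) p.2 := by
  unfold radMean
  apply intervalIntegral.continuous_parametric_intervalIntegral_of_continuous'
  have : Continuous fun q : (X × ℝ) × ℝ => Function.uncurry H (q.1.1, q.1.2 * q.2) := by fun_prop
  exact continuous_snd.mul this

lemma continuous_radInt_param {X : Type*} [TopologicalSpace X] [FirstCountableTopology X]
    {H : X → ℝ → ℝ} (hH : Continuous (Function.uncurry H)) :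
    Continuous fun p : X × ℝ => radInt (H p.1) p.2 := by
  have h := continuous_radMean_param hH
  have h2 : Continuous (Function.uncurry fun (x : X) (s : ℝ) => s * radMean (H x) s) :=
    continuous_snd.mul h
  exact intervalIntegral.continuous_parametric_primitive_of_continuous h2

lemma continuous_radMean {h : ℝ → ℝ} (hh : Continuous h) : Continuous (radMean h) := by
  have : Continuous (Function.uncurry fun (_ : Unit) (s : ℝ) => h s) := by
    simp only [Function.uncurry_def]; fun_prop
  exact (continuous_radMean_param this).comp (Continuous.prodMk_right ())

lemma hasDerivAt_radInt {h : ℝ → ℝ} (hh : Continuous h) (r : ℝ) :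
    HasDerivAt (radInt h) (r * radMean h r) r := by
  have hc : Continuous fun s => s * radMean h s := continuous_id.mul (continuous_radMean hh)
  exact intervalIntegral.integral_hasDerivAt_right (hc.intervalIntegrable _ _)
    (hc.stronglyMeasurableAtFilter _ _) hc.continuousAt

lemma sq_mul_radMean (h : ℝ → ℝ) (s : ℝ) : s ^ 2 * radMean h s = ∫ t in (0:ℝ)..s, t * h t := by
  have := intervalIntegral.mul_integral_comp_mul_left (a := 0) (b := 1)
    (f := fun t => t * h t) (c := s)
  rw [mul_zero, mul_one] at this
  rw [← this, radMean, pow_two, mul_assoc, ← intervalIntegral.integral_const_mul]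
  simp only [mul_assoc]

lemma hasDerivAt_sq_mul_radMean {h : ℝ → ℝ} (hh : Continuous h) (s : ℝ) :
    HasDerivAt (fun s => s ^ 2 * radMean h s) (s * h s) s := by
  have hc : Continuous fun t => t * h t := continuous_id.mul hh
  simp only [sq_mul_radMean]
  exact intervalIntegral.integral_hasDerivAt_right (hc.intervalIntegrable _ _)
    (hc.stronglyMeasurableAtFilter _ _) hc.continuousAt

lemma radMean_sub {h k : ℝ → ℝ} (hh : Continuous h) (hk : Continuous k) (s : ℝ) :
    radMean (fun t => h t - k t) s = radMean h s - radMean k s := by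
  unfold radMean
  rw [← intervalIntegral.integral_sub]
  · simp only [mul_sub]
  · exact Continuous.intervalIntegrable (by fun_prop) _ _
  · exact Continuous.intervalIntegrable (by fun_prop) _ _

lemma radInt_sub {h k : ℝ → ℝ} (hh : Continuous h) (hk : Continuous k) (r : ℝ) :
    radInt (fun t => h t - k t) r = radInt h r - radInt k r := by
  have h1 := continuous_radMean hh
  have h2 := continuous_radMean hk
  unfold radInt
  rw [← intervalIntegral.integral_sub]
  · simp only [radMean_sub hh hk, mul_sub]
  · exact Continuous.intervalIntegrable (by fun_prop) _ _
  · exact Continuous.intervalIntegrable (by fun_prop) _ _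

lemma abs_radMean_le {h : ℝ → ℝ} {s C : ℝ} (hC : ∀ t, |t| ≤ |s| → |h t| ≤ C) :
    |radMean h s| ≤ C := by
  have := intervalIntegral.norm_integral_le_of_norm_le_const (a := 0) (b := 1) (C := C)
    (f := fun τ => τ * h (s * τ)) ?_
  · simpa [radMean] using this
  intro τ hτ
  rw [uIoc_of_le zero_le_one] at hτ
  have h1 : |h (s * τ)| ≤ C := hC _ (by
    rw [abs_mul, abs_of_pos hτ.1]; exact mul_le_of_le_one_right (abs_nonneg _) hτ.2)
  rw [Real.norm_eq_abs, abs_mul, abs_of_pos hτ.1]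
  exact (mul_le_of_le_one_left (abs_nonneg _) hτ.2).trans h1

/-- The contraction estimate for `radInt` in the weighted norm with weight `exp (-L r²)`. -/
lemma abs_radInt_le {h : ℝ → ℝ} {L d : ℝ} (hL : 0 ≤ L) (hd : 0 ≤ d)
    (hb : ∀ s, |h s| ≤ L * d * Real.exp (L * s ^ 2)) (r : ℝ) :
    |radInt h r| ≤ d / 2 * Real.exp (L * r ^ 2) := by
  have key : ∀ s, |s * radMean h s| ≤ |s| * (L * d * Real.exp (L * s ^ 2)) := by
    intro s
    rw [abs_mul]
    refine mul_le_mul_of_nonneg_left (abs_radMean_le fun t ht => (hb t).trans ?_) (abs_nonneg _)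
    have := sq_le_sq.mpr ht
    gcongr
  have e1 : radInt h r = ∫ σ in (0:ℝ)..1, r * ((r * σ) * radMean h (r * σ)) := by
    have := intervalIntegral.mul_integral_comp_mul_left (a := 0) (b := 1)
      (f := fun t => t * radMean h t) (c := r)
    rw [mul_zero, mul_one] at this
    rw [intervalIntegral.integral_const_mul, this, radInt]
  have hder : ∀ σ ∈ uIcc (0:ℝ) 1, HasDerivAt (fun σ => d / 2 * Real.exp (L * (r * σ) ^ 2))
      (L * d * r ^ 2 * σ * Real.exp (L * (r * σ) ^ 2)) σ := by
    intro σ _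
    have := ((((hasDerivAt_id σ).const_mul r).pow 2).const_mul L).exp.const_mul (d / 2)
    refine this.congr_deriv ?_
    simp only [id, Pi.pow_apply]; push_cast; ring
  have hint : IntervalIntegrable (fun σ => L * d * r ^ 2 * σ * Real.exp (L * (r * σ) ^ 2))
      volume 0 1 := Continuous.intervalIntegrable (by fun_prop) _ _
  have e2 := intervalIntegral.integral_eq_sub_of_hasDerivAt hder hint
  have e3 : |radInt h r| ≤ ∫ σ in (0:ℝ)..1, L * d * r ^ 2 * σ * Real.exp (L * (r * σ) ^ 2) := by
    rw [e1, ← Real.norm_eq_abs]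
    refine intervalIntegral.norm_integral_le_of_norm_le zero_le_one ?_ hint
    refine Eventually.of_forall fun σ hσ => ?_
    rw [Real.norm_eq_abs, abs_mul]
    refine (mul_le_mul_of_nonneg_left (key (r * σ)) (abs_nonneg _)).trans (le_of_eq ?_)
    rw [abs_mul, abs_of_pos hσ.1, ← sq_abs r]
    ring
  rw [e2] at e3
  simp only [mul_one, mul_zero] at e3
  have : (0:ℝ) ≤ d / 2 * Real.exp (L * 0 ^ 2) := by positivity
  linarith

/-- Global solvability of `u'' + u'/r = -f_β(u)`, `u(0) = γ`, `u'(0) = 0`, in integral form and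
jointly continuously in the parameter. -/
lemma exists_radial_solution {f : ℝ → ℝ → ℝ} (hf : Continuous (Function.uncurry f))
    {L : ℝ → ℝ} (hLc : Continuous L) (hL : ∀ b, 0 ≤ L b)
    (hlip : ∀ b x y, |f b x - f b y| ≤ L b * |x - y|) (hf0 : ∀ b, f b 0 = 0) (γ : ℝ) :
    ∃ U : ℝ → ℝ → ℝ, Continuous (Function.uncurry U) ∧
      ∀ b r, U b r = γ - radInt (fun t => f b (U b t)) r := by
  let V : (ℝ × ℝ →ᵇ ℝ) → ℝ → ℝ → ℝ := fun y b t => Real.exp (L b * t ^ 2) * y (b, t)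
  have hV : ∀ y, Continuous (Function.uncurry (V y)) := by
    intro y
    change Continuous fun p : ℝ × ℝ => Real.exp (L p.1 * p.2 ^ 2) * y p
    fun_prop
  have hfV : ∀ y, Continuous (Function.uncurry fun b t => f b (V y b t)) := fun y =>
    hf.comp (continuous_fst.prodMk (hV y))
  have hfV' : ∀ y b, Continuous fun t => f b (V y b t) := fun y b =>
    (hfV y).comp (Continuous.prodMk_right b)
  have hdiff : ∀ y z b r, |radInt (fun t => f b (V y b t)) r - radInt (fun t => f b (V z b t)) r|
      ≤ dist y z / 2 * Real.exp (L b * r ^ 2) := by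
    intro y z b r
    rw [← radInt_sub (hfV' y b) (hfV' z b)]
    refine abs_radInt_le (hL b) dist_nonneg (fun s => ?_) r
    refine (hlip _ _ _).trans ?_
    rw [mul_assoc]
    refine mul_le_mul_of_nonneg_left ?_ (hL b)
    rw [← mul_sub, abs_mul, abs_of_pos (Real.exp_pos _), mul_comm]
    exact mul_le_mul_of_nonneg_right (y.dist_coe_le_dist (g := z) (b, s)) (Real.exp_pos _).le
  have hcancel : ∀ (b r c : ℝ), Real.exp (-(L b * r ^ 2)) * (c * Real.exp (L b * r ^ 2)) = c := by
    intro b r c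
    rw [mul_left_comm, ← Real.exp_add]; simp
  have hV0 : ∀ b r, radInt (fun t => f b (V 0 b t)) r = 0 := by
    intro b r
    simp [V, hf0, radInt, radMean]
  let T : (ℝ × ℝ →ᵇ ℝ) → (ℝ × ℝ →ᵇ ℝ) := fun y =>
    BoundedContinuousFunction.ofNormedAddCommGroup
      (fun p => Real.exp (-(L p.1 * p.2 ^ 2)) * (γ - radInt (fun t => f p.1 (V y p.1 t)) p.2))
      (by
        have := continuous_radInt_param (hfV y)
        fun_prop) (|γ| + dist y 0 / 2) (by
        rintro ⟨b, r⟩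
        have h1 := hdiff y 0 b r
        rw [hV0, sub_zero] at h1
        have h2 : Real.exp (-(L b * r ^ 2)) ≤ 1 :=
          Real.exp_le_one_iff.mpr (by have := mul_nonneg (hL b) (sq_nonneg r); linarith)
        have h3 := mul_le_mul_of_nonneg_left h1 (Real.exp_pos (-(L b * r ^ 2))).le
        rw [hcancel] at h3
        rw [Real.norm_eq_abs, abs_mul, abs_of_pos (Real.exp_pos _)]
        calc _ ≤ Real.exp (-(L b * r ^ 2)) * (|γ| + |radInt (fun t => f b (V y b t)) r|) := by
              gcongr; exact abs_sub _ _
          _ ≤ _ := by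
              rw [mul_add]
              exact add_le_add (mul_le_of_le_one_left (abs_nonneg _) h2) h3)
  have hT : ContractingWith (1/2 : ℝ≥0) T := by
    refine ⟨by rw [← NNReal.coe_lt_coe]; norm_num, LipschitzWith.of_dist_le_mul fun y z => ?_⟩
    refine (BoundedContinuousFunction.dist_le (by positivity)).mpr ?_
    rintro ⟨b, r⟩
    have h3 := mul_le_mul_of_nonneg_left (hdiff y z b r) (Real.exp_pos (-(L b * r ^ 2))).le
    rw [hcancel] at h3
    have e : T y (b, r) - T z (b, r) = -(Real.exp (-(L b * r ^ 2)) *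
        (radInt (fun t => f b (V y b t)) r - radInt (fun t => f b (V z b t)) r)) := by
      simp only [T, BoundedContinuousFunction.coe_ofNormedAddCommGroup]; ring
    rw [Real.dist_eq, e, abs_neg, abs_mul, abs_of_pos (Real.exp_pos _)]
    refine h3.trans (le_of_eq ?_)
    push_cast; ring
  obtain ⟨y, hy⟩ : ∃ y, T y = y := ⟨_, hT.fixedPoint_isFixedPt⟩
  refine ⟨V y, hV y, fun b r => ?_⟩
  have h1 : T y (b, r) = y (b, r) := by rw [hy]
  simp only [T, BoundedContinuousFunction.coe_ofNormedAddCommGroup] at h1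
  change Real.exp (L b * r ^ 2) * y (b, r) = _
  rw [← h1, ← mul_assoc, ← Real.exp_add]
  simp

lemma contDiff_integral_pow_mul (n : ℕ) : ∀ (m : ℕ) {h : ℝ → ℝ}, ContDiff ℝ n h →
    ContDiff ℝ n fun s => ∫ τ in (0:ℝ)..1, τ ^ m * h (s * τ) := by
  induction n with
  | zero =>
    intro m h hh
    have hc : Continuous h := hh.continuous
    refine contDiff_zero.mpr ?_
    apply intervalIntegral.continuous_parametric_intervalIntegral_of_continuous'
    simp only [Function.uncurry_def]; fun_prop
  | succ n ih =>
    intro m h hh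
    have hc : Continuous h := hh.continuous
    push_cast at hh ⊢
    rw [contDiff_succ_iff_deriv] at hh
    have hc' : Continuous (deriv h) := hh.2.2.continuous
    have key : ∀ s, HasDerivAt (fun s => ∫ τ in (0:ℝ)..1, τ ^ m * h (s * τ))
        (∫ τ in (0:ℝ)..1, τ ^ (m + 1) * deriv h (s * τ)) s := by
      intro s
      have hK : IsCompact (Metric.closedBall s 1 ×ˢ Icc (0:ℝ) 1) :=
        (isCompact_closedBall s 1).prod isCompact_Icc
      have hcF : Continuous fun p : ℝ × ℝ => p.2 ^ (m + 1) * deriv h (p.1 * p.2) := by fun_prop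
      obtain ⟨C, hC⟩ := hK.exists_bound_of_continuousOn hcF.continuousOn
      refine (intervalIntegral.hasDerivAt_integral_of_dominated_loc_of_deriv_le
        (F := fun s τ => τ ^ m * h (s * τ)) (F' := fun s τ => τ ^ (m + 1) * deriv h (s * τ))
        (bound := fun _ => C) (Metric.closedBall_mem_nhds s one_pos) ?_ ?_ ?_ ?_ ?_ ?_).2
      · refine Eventually.of_forall fun x => Continuous.aestronglyMeasurable (by fun_prop)
      · exact Continuous.intervalIntegrable (by fun_prop) _ _
      · exact Continuous.aestronglyMeasurable (by fun_prop)
      · refine Eventually.of_forall fun t ht x hx => ?_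
        rw [uIoc_of_le zero_le_one] at ht
        exact hC (x, t) ⟨hx, ht.1.le, ht.2⟩
      · exact intervalIntegrable_const
      · refine Eventually.of_forall fun t _ x _ => ?_
        have h1 : HasDerivAt h (deriv h (x * t)) (x * t) := (hh.1 _).hasDerivAt
        have h2 : HasDerivAt (fun x : ℝ => x * t) (1 * t) x := (hasDerivAt_id x).mul_const t
        refine ((h1.comp x h2).const_mul (t ^ m)).congr_deriv ?_
        ring
    rw [contDiff_succ_iff_deriv]
    refine ⟨fun s => (key s).differentiableAt, by simp, ?_⟩
    rw [show deriv (fun s => ∫ τ in (0:ℝ)..1, τ ^ m * h (s * τ)) = _ from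
      funext fun s => (key s).deriv]
    exact ih (m + 1) hh.2.2

lemma contDiff_radMean {n : ℕ} {h : ℝ → ℝ} (hh : ContDiff ℝ n h) : ContDiff ℝ n (radMean h) := by
  simpa [radMean] using! contDiff_integral_pow_mul n 1 hh

lemma hasDerivAt_of_eq_sub_radInt {u h : ℝ → ℝ} (hh : Continuous h) {γ : ℝ}
    (hu : ∀ r, u r = γ - radInt h r) (r : ℝ) : HasDerivAt u (-(r * radMean h r)) r := by
  rw [show u = fun r => γ - radInt h r from funext hu]
  exact (hasDerivAt_radInt hh r).const_sub γ

/-- Bootstrapping: continuous solutions of the integral equation are smooth. -/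
lemma contDiff_of_eq_sub_radInt {u F : ℝ → ℝ} (hF : ContDiff ℝ ∞ F) (huc : Continuous u) {γ : ℝ}
    (hu : ∀ r, u r = γ - radInt (fun t => F (u t)) r) : ContDiff ℝ ∞ u := by
  have hder := hasDerivAt_of_eq_sub_radInt (hF.continuous.comp huc) hu
  rw [contDiff_infty]
  intro n
  induction n with
  | zero => exact contDiff_zero.mpr huc
  | succ n ih =>
    push_cast
    rw [contDiff_succ_iff_deriv]
    refine ⟨fun s => (hder s).differentiableAt, by simp, ?_⟩
    rw [show deriv u = _ from funext fun s => (hder s).deriv]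
    have h1 : ContDiff ℝ n (radMean fun t => F (u t)) :=
      contDiff_radMean ((contDiff_infty.mp hF n).comp ih)
    exact (contDiff_id.mul h1).neg

lemma radLap_of_eq_sub_radInt {u h : ℝ → ℝ} (hh : Continuous h) {γ : ℝ}
    (hu : ∀ r, u r = γ - radInt h r) {r : ℝ} (hr : 0 < r) : radLap u r = h r := by
  have hder := hasDerivAt_of_eq_sub_radInt hh hu
  have h1 : HasDerivAt (fun s => -(s ^ 2 * radMean h s / s))
      (-((r * h r * r - r ^ 2 * radMean h r * 1) / r ^ 2)) r :=
    ((hasDerivAt_sq_mul_radMean hh r).div (hasDerivAt_id r) hr.ne').neg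
  have h2 : deriv u =ᶠ[𝓝 r] fun s => -(s ^ 2 * radMean h s / s) := by
    filter_upwards [lt_mem_nhds hr] with s hs
    rw [(hder s).deriv]
    field_simp
  rw [radLap, h2.deriv_eq, h1.deriv, (hder r).deriv]
  field_simp
  ring

lemma radMean_nonneg {h : ℝ → ℝ} {s : ℝ} (hs : 0 ≤ s) (h0 : ∀ t ∈ Icc 0 s, 0 ≤ h t) :
    0 ≤ radMean h s :=
  intervalIntegral.integral_nonneg zero_le_one fun _ hτ => mul_nonneg hτ.1
    (h0 _ ⟨mul_nonneg hs hτ.1, mul_le_of_le_one_right hs hτ.2⟩)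

lemma radMean_pos {h : ℝ → ℝ} (hh : Continuous h) {s : ℝ} (hs : 0 < s)
    (h0 : ∀ t ∈ Icc 0 s, 0 ≤ h t) (hpos : 0 < h 0) : 0 < radMean h s := by
  have hc : Continuous fun τ => τ * h (s * τ) := by fun_prop
  refine intervalIntegral.integral_pos zero_lt_one hc.continuousOn (fun _ hτ => mul_nonneg hτ.1.le
    (h0 _ ⟨mul_nonneg hs.le hτ.1.le, mul_le_of_le_one_right hs.le hτ.2⟩)) ?_
  have h1 : ∀ᶠ τ in 𝓝 (0:ℝ), 0 < h (s * τ) :=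
    (show Continuous fun τ => h (s * τ) by fun_prop).tendsto 0 |>.eventually
      (lt_mem_nhds (by simpa using hpos))
  have h2 : ∀ᶠ τ in 𝓝[>] (0:ℝ), τ ∈ Ioo (0:ℝ) 1 := Ioo_mem_nhdsGT one_pos
  obtain ⟨τ, h3, h4⟩ := ((h1.filter_mono nhdsWithin_le_nhds).and h2).exists
  exact ⟨τ, Ioo_subset_Icc_self h4, mul_pos h4.1 h3⟩

/-- The flux `p = r v₁'` of the eigenfunction. -/
lemma EigenCtx.exists_flux {lam1 : ℝ} {v1 : ℝ → ℝ} (hE : EigenCtx lam1 v1) :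
    ∃ p : ℝ → ℝ, ContinuousOn p (Icc 0 1) ∧ p 0 = 0 ∧ (∀ r ∈ Icc (0:ℝ) 1, p r ≤ 0) ∧
      ∀ r ∈ Ioo (0:ℝ) 1, HasDerivAt v1 (p r / r) r ∧ HasDerivAt p (-(lam1 * r * v1 r)) r := by
  obtain ⟨hl, hs, hode, hpos, -, -⟩ := hE
  have hcont : ContinuousOn (fun r => r * derivWithin v1 (Icc 0 1) r) (Icc 0 1) :=
    continuousOn_id.mul
      (hs.continuousOn_derivWithin (uniqueDiffOn_Icc zero_lt_one) (by simp))
  have hnhds : ∀ r ∈ Ioo (0:ℝ) 1, derivWithin v1 (Icc 0 1) =ᶠ[𝓝 r] deriv v1 := by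
    intro r hr
    filter_upwards [Ioo_mem_nhds hr.1 hr.2] with s hs
    exact derivWithin_of_mem_nhds (Icc_mem_nhds hs.1 hs.2)
  have hder : ∀ r ∈ Ioo (0:ℝ) 1,
      HasDerivAt v1 ((r * derivWithin v1 (Icc 0 1) r) / r) r ∧
      HasDerivAt (fun r => r * derivWithin v1 (Icc 0 1) r) (-(lam1 * r * v1 r)) r := by
    intro r hr
    have hat : ContDiffAt ℝ ∞ v1 r := hs.contDiffAt (Icc_mem_nhds hr.1 hr.2)
    have hd1 : HasDerivAt v1 (deriv v1 r) r := (hat.differentiableAt (by simp)).hasDerivAt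
    have hd2 : HasDerivAt (deriv v1) (deriv (deriv v1) r) r := by
      have : ContDiffAt ℝ 1 (deriv v1) r := hat.derivWithin (by norm_cast)
      exact (this.differentiableAt (by simp)).hasDerivAt
    have hr0 : r ≠ 0 := hr.1.ne'
    constructor
    · rw [(hnhds r hr).eq_of_nhds, mul_div_cancel_left₀ _ hr0]
      exact hd1
    · have h3 := (hasDerivAt_id r).mul hd2
      have h4 : (fun r => r * derivWithin v1 (Icc 0 1) r) =ᶠ[𝓝 r] id * deriv v1 := by
        filter_upwards [hnhds r hr] with s hs
        simp [hs]
      refine (h3.congr_of_eventuallyEq h4).congr_deriv ?_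
      have h5 := hode r hr
      rw [radLap] at h5
      field_simp at h5
      simp only [id]
      linarith
  have hanti : AntitoneOn (fun r => r * derivWithin v1 (Icc 0 1) r) (Icc 0 1) := by
    refine antitoneOn_of_deriv_nonpos (convex_Icc 0 1) hcont ?_ ?_
    · rw [interior_Icc]
      exact fun r hr => (hder r hr).2.differentiableAt.differentiableWithinAt
    · rw [interior_Icc]
      intro r hr
      rw [(hder r hr).2.deriv]
      have := mul_pos (mul_pos hl hr.1) (hpos r ⟨hr.1.le, hr.2⟩)
      linarith
  refine ⟨_, hcont, by simp, fun r hr => ?_, hder⟩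
  simpa using hanti (left_mem_Icc.mpr zero_le_one) hr hr.1

/-- Monotonicity of the Wronskian of a radial solution of `u'' + u'/r = -h` and of the
eigenfunction, when the latter is dominated on `(0, z)`. -/
lemma strictMonoOn_wronskian {lam1 γ z : ℝ} {v1 p u h : ℝ → ℝ} (hv : ContinuousOn v1 (Icc 0 1))
    (hpc : ContinuousOn p (Icc 0 1))
    (hp : ∀ r ∈ Ioo (0:ℝ) 1, HasDerivAt v1 (p r / r) r ∧ HasDerivAt p (-(lam1 * r * v1 r)) r)
    (hh : Continuous h) (hu : ∀ r, u r = γ - radInt h r) (hz : z ≤ 1)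
    (hlt : ∀ r ∈ Ioo 0 z, 0 < (lam1 * u r - h r) * v1 r) :
    StrictMonoOn (fun r => -(r ^ 2 * radMean h r) * v1 r - u r * p r) (Icc 0 z) := by
  have hder := hasDerivAt_of_eq_sub_radInt hh hu
  have huc : Continuous u := continuous_iff_continuousAt.mpr fun r => (hder r).continuousAt
  have hm := continuous_radMean hh
  have hsub : Icc 0 z ⊆ Icc (0:ℝ) 1 := Icc_subset_Icc le_rfl hz
  refine strictMonoOn_of_deriv_pos (convex_Icc 0 z) ?_ ?_
  · refine ContinuousOn.sub (ContinuousOn.mul ?_ (hv.mono hsub))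
      (huc.continuousOn.mul (hpc.mono hsub))
    exact Continuous.continuousOn (by fun_prop)
  · rw [interior_Icc]
    intro r hr
    obtain ⟨h1, h2⟩ := hp r ⟨hr.1, hr.2.trans_le hz⟩
    have h3 := ((hasDerivAt_sq_mul_radMean hh r).neg.mul h1).sub ((hder r).mul h2)
    have h4 : (-(r * h r)) * v1 r + -(r ^ 2 * radMean h r) * (p r / r) -
        (-(r * radMean h r) * p r + u r * (-(lam1 * r * v1 r))) =
        r * ((lam1 * u r - h r) * v1 r) := by
      have := hr.1.ne'
      field_simp
      ring
    have h5 := h3.congr_deriv h4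
    have h6 : deriv (fun r => -(r ^ 2 * radMean h r) * v1 r - u r * p r) r =
        r * ((lam1 * u r - h r) * v1 r) := h5.deriv
    rw [h6]
    exact mul_pos hr.1 (hlt r hr)

/-- Below the first eigenvalue, the linear radial solution does not vanish on the disk. -/
lemma EigenCtx.pos_of_lt {lam1 lam γ : ℝ} {v1 u : ℝ → ℝ} (hE : EigenCtx lam1 v1) (hlam : 0 < lam)
    (hlt : lam < lam1) (hγ : 0 < γ) (huc : Continuous u)
    (hu : ∀ r, u r = γ - radInt (fun t => lam * u t) r) : ∀ r ∈ Icc (0:ℝ) 1, 0 < u r := by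
  obtain ⟨p, hpc, hp0, hpn, hp⟩ := hE.exists_flux
  obtain ⟨-, hs, -, hpos, hv1, -⟩ := hE
  by_contra! hne
  obtain ⟨z, ⟨hz, hzu⟩, hmin⟩ : ∃ z, IsLeast (Icc (0:ℝ) 1 ∩ u ⁻¹' Iic 0) z :=
    (isCompact_Icc.inter_right (isClosed_Iic.preimage huc)).exists_isLeast hne
  have hu0 : u 0 = γ := by simp [hu 0, radInt]
  have hz0 : 0 < z := by
    refine hz.1.lt_of_ne fun h => ?_
    rw [← h] at hzu
    exact absurd hzu (by simp [hu0, hγ])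
  have hup : ∀ r ∈ Ico 0 z, 0 < u r := by
    intro r hr
    by_contra! h
    exact absurd (hmin ⟨⟨hr.1, hr.2.le.trans hz.2⟩, h⟩) (not_le.mpr hr.2)
  have huz : 0 ≤ u z := by
    have h1 : z ∈ closure (Ico 0 z) := by
      rw [closure_Ico hz0.ne]; exact ⟨hz0.le, le_rfl⟩
    exact closure_minimal (fun r hr => (hup r hr).le) (isClosed_Ici.preimage huc) h1
  have hh : Continuous fun t => lam * u t := by fun_prop
  have hW := strictMonoOn_wronskian hs.continuousOn hpc hp hh hu hz.2 (fun r hr => by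
    have h1 := hpos r ⟨hr.1.le, hr.2.trans_le hz.2⟩
    have h2 := mul_pos (sub_pos.mpr hlt) (hup r ⟨hr.1.le, hr.2⟩)
    rw [sub_mul] at h2
    exact mul_pos h2 h1) ⟨le_rfl, hz.1⟩ ⟨hz.1, le_rfl⟩ hz0
  have hvz : 0 ≤ v1 z := by
    rcases hz.2.lt_or_eq with h | h
    · exact (hpos z ⟨hz.1, h⟩).le
    · rw [h, hv1]
  have hm : 0 ≤ radMean (fun t => lam * u t) z := radMean_nonneg hz.1 fun t ht => by
    rcases ht.2.lt_or_eq with h | h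
    · exact mul_nonneg hlam.le (hup t ⟨ht.1, h⟩).le
    · rw [h]; exact mul_nonneg hlam.le huz
  have huz' : u z = 0 := le_antisymm hzu huz
  simp only [hp0, huz'] at hW
  have := mul_nonneg (mul_nonneg (sq_nonneg z) hm) hvz
  linarith

/-- A strict radial supersolution of the eigenvalue equation is negative at the boundary. -/
lemma EigenCtx.neg_of_gt {lam1 γ : ℝ} {v1 u h : ℝ → ℝ} (hE : EigenCtx lam1 v1)
    (hh : Continuous h) (hu : ∀ r, u r = γ - radInt h r)
    (hlt : ∀ r ∈ Ioo (0:ℝ) 1, lam1 * u r < h r) : u 1 < 0 := by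
  obtain ⟨p, hpc, hp0, hpn, hp⟩ := hE.exists_flux
  obtain ⟨-, hs, -, hpos, hv1, -⟩ := hE
  have hp' : ∀ r ∈ Ioo (0:ℝ) 1, HasDerivAt (-v1) (-p r / r) r ∧
      HasDerivAt (-p) (-(lam1 * r * (-v1) r)) r := by
    intro r hr
    obtain ⟨h1, h2⟩ := hp r hr
    exact ⟨h1.neg.congr_deriv (by ring), h2.neg.congr_deriv (by simp)⟩
  have hW := strictMonoOn_wronskian hs.continuousOn.neg hpc.neg hp' hh hu le_rfl (fun r hr => by
    have h1 := hpos r ⟨hr.1.le, hr.2⟩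
    exact mul_pos_of_neg_of_neg (sub_neg.mpr (hlt r hr)) (by simpa using h1))
    (left_mem_Icc.mpr zero_le_one) (right_mem_Icc.mpr zero_le_one) one_pos
  simp only [Pi.neg_apply, hp0, hv1] at hW
  by_contra! hc
  have := mul_nonneg hc (neg_nonneg.mpr (hpn 1 (right_mem_Icc.mpr zero_le_one)))
  linarith

/-- A smooth, globally Lipschitz modification of `x * exp (x ^ 2)` away from `[0, γ]`. -/
lemma exists_truncated_exp {γ : ℝ} (hγ : 0 < γ) : ∃ (g : ℝ → ℝ) (M : ℝ≥0), ContDiff ℝ ∞ g ∧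
    LipschitzWith M g ∧ (∀ x, 0 ≤ x → 0 ≤ g x) ∧ g 0 = 0 ∧
    ∀ x ∈ Icc 0 γ, g x = x * Real.exp (x ^ 2) := by
  let χ : ContDiffBump (0:ℝ) := ⟨γ, γ + 1, hγ, by linarith⟩
  have hc : ContDiff ℝ ∞ fun x => χ x * (x * Real.exp (x ^ 2)) :=
    χ.contDiff.mul (by fun_prop)
  obtain ⟨M, hM⟩ := ContDiff.lipschitzWith_of_hasCompactSupport
    (χ.hasCompactSupport.mul_right (f' := fun x => x * Real.exp (x ^ 2))) hc (by simp)
  refine ⟨_, M, hc, hM, fun x hx => ?_, by simp, fun x hx => ?_⟩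
  · have := χ.nonneg' x
    positivity
  · have : χ x = 1 := χ.one_of_mem_closedBall (by
      rw [mem_closedBall_zero_iff, Real.norm_eq_abs, abs_of_nonneg hx.1]; exact hx.2)
    simp [this]

/-- Shooting in `β`: below the first eigenvalue, there is a positive radial solution with any
prescribed central value. -/
lemma EigenCtx.exists_isRadSol {lam1 lam γ : ℝ} {v1 : ℝ → ℝ} (hE : EigenCtx lam1 v1)
    (hlam : 0 < lam) (hlt : lam < lam1) (hγ : 0 < γ) :
    ∃ beta : ℝ, 0 < beta ∧ ∃ u : ℝ → ℝ, IsRadSol lam beta γ u := by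
  have hl1 : 0 < lam1 := hE.1
  obtain ⟨g, M, hg, hgL, hg0, hgz, hgeq⟩ := exists_truncated_exp hγ
  have hF : ∀ b, ContDiff ℝ ∞ fun x => lam * x + b * g x := fun b => by fun_prop
  have hgc := hg.continuous
  obtain ⟨U, hUc, hU⟩ := exists_radial_solution (f := fun b x => lam * x + b * g x)
    (by simp only [Function.uncurry_def]; fun_prop) (L := fun b => lam + |b| * M) (by fun_prop)
    (fun b => by positivity) (fun b x y => by
      have h1 := hgL.dist_le_mul x y
      rw [Real.dist_eq, Real.dist_eq] at h1
      have e : lam * x + b * g x - (lam * y + b * g y) = lam * (x - y) + b * (g x - g y) := by ring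
      rw [e]
      refine (abs_add_le _ _).trans ?_
      rw [abs_mul, abs_mul, abs_of_pos hlam, add_mul, mul_assoc]
      gcongr) (fun b => by simp [hgz]) γ
  have hUb : ∀ b, Continuous (U b) := fun b => hUc.comp (Continuous.prodMk_right b)
  have hUh : ∀ b, Continuous fun t => lam * U b t + b * g (U b t) := fun b =>
    (hF b).continuous.comp (hUb b)
  have hU0 : ∀ b, U b 0 = γ := fun b => by simp [hU b 0, radInt]
  have hanti : ∀ b, 0 ≤ b → (∀ r ∈ Icc (0:ℝ) 1, 0 ≤ U b r) →
      StrictAntiOn (U b) (Icc 0 1) := by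
    intro b hb hnn
    refine strictAntiOn_of_deriv_neg (convex_Icc 0 1) (hUb b).continuousOn ?_
    rw [interior_Icc]
    intro r hr
    rw [(hasDerivAt_of_eq_sub_radInt (hUh b) (hU b) r).deriv]
    refine neg_neg_of_pos (mul_pos hr.1 (radMean_pos (hUh b) hr.1 (fun t ht => ?_) ?_))
    · have := hnn t ⟨ht.1, ht.2.trans hr.2.le⟩
      have := hg0 _ this
      positivity
    · have := hg0 γ hγ.le
      rw [hU0]
      positivity
  let m : ℝ → ℝ := fun b => sInf (U b '' Icc 0 1)
  have hmc : Continuous m := isCompact_Icc.continuous_sInf hUc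
  have hmin : ∀ b, ∃ r ∈ Icc (0:ℝ) 1, m b = U b r ∧ ∀ s ∈ Icc (0:ℝ) 1, U b r ≤ U b s :=
    fun b => isCompact_Icc.exists_sInf_image_eq_and_le (nonempty_Icc.mpr zero_le_one)
      (hUb b).continuousOn
  have hbd : ∀ b, 0 ≤ b → (∀ r ∈ Icc (0:ℝ) 1, 0 ≤ U b r) → ∀ r ∈ Icc (0:ℝ) 1,
      g (U b r) = U b r * Real.exp (U b r ^ 2) := by
    intro b hb hnn r hr
    refine hgeq _ ⟨hnn r hr, ?_⟩
    rw [← hU0 b]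
    exact (hanti b hb hnn).antitoneOn (left_mem_Icc.mpr zero_le_one) hr hr.1
  have hm0 : 0 < m 0 := by
    obtain ⟨r, hr, h1, -⟩ := hmin 0
    rw [h1]
    exact hE.pos_of_lt hlam hlt hγ (hUb 0) (fun r => by simpa using hU 0 r) r hr
  have hm1 : m lam1 ≤ 0 := by
    by_contra! hc
    obtain ⟨r, hr, h1, h2⟩ := hmin lam1
    have hp : ∀ s ∈ Icc (0:ℝ) 1, 0 < U lam1 s := fun s hs => by
      rw [h1] at hc; exact hc.trans_le (h2 s hs)
    have := hE.neg_of_gt (hUh lam1) (hU lam1) (fun s hs => by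
      have hs' := Ioo_subset_Icc_self hs
      have h3 := hp s hs'
      rw [hbd lam1 hl1.le (fun r hr => (hp r hr).le) s hs']
      have h4 : 1 ≤ Real.exp (U lam1 s ^ 2) := Real.one_le_exp (sq_nonneg _)
      have h5 : U lam1 s ≤ U lam1 s * Real.exp (U lam1 s ^ 2) := le_mul_of_one_le_right h3.le h4
      have h6 := mul_le_mul_of_nonneg_left h5 hl1.le
      have h7 := mul_pos hlam h3
      linarith)
    exact absurd (hp 1 (right_mem_Icc.mpr zero_le_one)) (not_lt.mpr this.le)
  obtain ⟨b, hb, hmb⟩ := intermediate_value_Icc' hl1.le hmc.continuousOn ⟨hm1, hm0.le⟩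
  obtain ⟨z, hz, h1, h2⟩ := hmin b
  have hb0 : b ≠ 0 := by
    rintro rfl
    exact hm0.ne' hmb
  have hUz : U b z = 0 := by rw [← h1, hmb]
  have hnn : ∀ r ∈ Icc (0:ℝ) 1, 0 ≤ U b r := fun r hr => hUz ▸ h2 r hr
  have han := hanti b hb.1 hnn
  have h1m : (1:ℝ) ∈ Icc (0:ℝ) 1 := right_mem_Icc.mpr zero_le_one
  have hU1 : U b 1 = 0 :=
    le_antisymm (hUz ▸ han.antitoneOn hz h1m hz.2) (hnn 1 h1m)
  refine ⟨b, hb.1.lt_of_ne' hb0, U b, ?_, fun r hr => ?_, fun r hr => ?_, hU1, hU0 b⟩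
  · exact (contDiff_of_eq_sub_radInt (hF b) (hUb b) (hU b)).contDiffOn
  · rw [radLap_of_eq_sub_radInt (hUh b) (hU b) hr.1, hbd b hb.1 hnn r (Ioo_subset_Icc_self hr),
      mul_assoc]
  · rw [← hU1]
    exact han (Ico_subset_Icc_self hr) h1m hr.2

/-- existence part of Theorem 1. Let l > 0 and
λ̄_γ = λ₁ − (4π v₁(0)/γ)√(λ₁/l). For every γ > 0 with λ̄_γ > 0 there exists β_γ > 0 such
that Δu = λ̄_γ u + β_γ u e^{u²}, u > 0 in Ω, u = 0 on ∂Ω has a smooth radial solution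
u_γ with u_γ(0) = γ. -/
theorem statement5 (lam1 : ℝ) (v1 : ℝ → ℝ) (hE : EigenCtx lam1 v1) (l : ℝ) (hl : 0 < l) :
    ∀ γ : ℝ, 0 < γ → 0 < lamBar lam1 (v1 0) l γ →
      ∃ beta : ℝ, 0 < beta ∧ ∃ u : ℝ → ℝ, IsRadSol (lamBar lam1 (v1 0) l γ) beta γ u := by
  intro γ hγ hpos
  have hl1 : 0 < lam1 := hE.1
  have hv0 : 0 < v1 0 := hE.2.2.2.1 0 ⟨le_rfl, zero_lt_one⟩
  refine hE.exists_isRadSol hpos ?_ hγ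
  have : 0 < 4 * π * v1 0 / γ * Real.sqrt (lam1 / l) := by positivity
  rw [lamBar]
  linarith

end
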